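/- arXiv:1611.02743 — 2 statements merged into one kernel-verified Lean document; each statement's English description precedes it below -/
import Mathlib

section
/- Let A₁, A₂, A₃ ∈ SL(2,ℂ) have all seven traces tr ρ(w) (w ∈ {a₁,a₂,a₃,a₁a₂,a₁a₃,a₂a₃,a₁a₂a₃}) real, and suppose (A₁,A₂,A₃) is elementwise-periodic. Write p = χ(id) ∈ ℝ⁷. Then at least one of the following holds: (i) at most one coordinate of p is nonzero (p lies on a coordinate axis); (ii) there is a set S among S₁ = {1,2,3,7}, S₂ = {1,2,5,6}, S₃ = {1,3,4,6}, S₄ = {1,4,5,7}, S₅ = {2,3,4,5}, S₆ = {2,4,6,7}, S₇ = {3,5,6,7} with p_s = 0 for all s ∈ S; (iii) there exists t ∈ ℝ³ with p = Π₃(t); (iv) the subgroup of SL(2,ℂ) generated by A₁, A₂, A₃ is finite. Moreover, in all cases the full orbit set {χ(α) : α an automorphism of F₃} is finite. -/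
open Matrix Real

noncomputable section

abbrev SL2C := Matrix.SpecialLinearGroup (Fin 2) ℂ

/-- The representation `F₃ → SL(2,ℂ)` sending `aᵢ ↦ Aᵢ`. -/
def rho (A₁ A₂ A₃ : SL2C) : FreeGroup (Fin 3) →* SL2C := FreeGroup.lift ![A₁, A₂, A₃]

/-- The seven words `a₁, a₂, a₃, a₁a₂, a₁a₃, a₂a₃, a₁a₂a₃`, indexed `0,…,6`. -/
def w : Fin 7 → FreeGroup (Fin 3) :=
  ![FreeGroup.of 0, FreeGroup.of 1, FreeGroup.of 2,
    FreeGroup.of 0 * FreeGroup.of 1, FreeGroup.of 0 * FreeGroup.of 2,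
    FreeGroup.of 1 * FreeGroup.of 2, FreeGroup.of 0 * FreeGroup.of 1 * FreeGroup.of 2]

/-- `χ(α) = (tr ρ(α(w))/2)_w ∈ ℂ⁷`. -/
def chi (A₁ A₂ A₃ : SL2C) (α : MulAut (FreeGroup (Fin 3))) : Fin 7 → ℂ :=
  fun i => Matrix.trace ((rho A₁ A₂ A₃ (α (w i)) : Matrix (Fin 2) (Fin 2) ℂ)) / 2

/-- `(A₁,A₂,A₃)` is elementwise-periodic. -/
def ElemPeriodic (A₁ A₂ A₃ : SL2C) : Prop :=
  ∀ α : MulAut (FreeGroup (Fin 3)), (Set.range fun k : ℕ => chi A₁ A₂ A₃ (α ^ k)).Finite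

/-- `Π₃(t₁,t₂,t₃)`. -/
def Pi3 (t₁ t₂ t₃ : ℝ) : Fin 7 → ℝ :=
  ![Real.cos (2 * π * t₁), Real.cos (2 * π * t₂), Real.cos (2 * π * t₃),
    Real.cos (2 * π * (t₁ + t₂)), Real.cos (2 * π * (t₁ + t₃)),
    Real.cos (2 * π * (t₂ + t₃)), Real.cos (2 * π * (t₁ + t₂ + t₃))]

/-- The seven position sets `S₁,…,S₇` (1-indexed `{1,2,3,7}` etc. become
0-indexed `{0,1,2,6}` etc.). -/
def SS : Fin 7 → Finset (Fin 7) :=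
  ![{0, 1, 2, 6}, {0, 1, 4, 5}, {0, 2, 3, 5}, {0, 3, 4, 6},
    {1, 2, 3, 4}, {1, 3, 5, 6}, {2, 4, 5, 6}]


abbrev F3 := FreeGroup (Fin 3)
abbrev M2 (S : Type*) := Matrix (Fin 2) (Fin 2) S

/-! ### Elementary identities for two by two matrices -/

lemma m2_polar {S : Type*} [CommRing S] (X Y : M2 S) :
    Y * X = -(X * Y) + X.trace • Y + Y.trace • X + ((X * Y).trace - X.trace * Y.trace) • 1 := by
  ext i j
  fin_cases i <;> fin_cases j <;>
    simp [Matrix.mul_apply, Matrix.trace, Fin.sum_univ_two] <;> ring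

lemma m2_ch {S : Type*} [CommRing S] (X : M2 S) (h : X.det = 1) :
    X * X = X.trace • X - 1 := by
  rw [Matrix.det_fin_two] at h
  ext i j
  fin_cases i <;> fin_cases j <;>
    simp [Matrix.mul_apply, Matrix.trace, Fin.sum_univ_two]
  · linear_combination -h
  · ring
  · ring
  · linear_combination -h

lemma m2_fricke {S : Type*} [CommRing S] (A B C : M2 S) :
    (A * B * C).trace * (A * C * B).trace =
      A.trace ^ 2 * B.det * C.det + B.trace ^ 2 * A.det * C.det + C.trace ^ 2 * A.det * B.det
      + (A * B).trace ^ 2 * C.det + (B * C).trace ^ 2 * A.det + (A * C).trace ^ 2 * B.det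
      - A.trace * B.trace * (A * B).trace * C.det - B.trace * C.trace * (B * C).trace * A.det
      - A.trace * C.trace * (A * C).trace * B.det
      + (A * B).trace * (B * C).trace * (A * C).trace - 4 * A.det * B.det * C.det := by
  simp only [Matrix.mul_apply, Matrix.trace, Fin.sum_univ_two, Matrix.det_fin_two, Matrix.diag]
  ring

lemma m2_fricke_sum {S : Type*} [CommRing S] (A B C : M2 S) :
    (A * B * C).trace + (A * C * B).trace =
      A.trace * (B * C).trace + B.trace * (A * C).trace + C.trace * (A * B).trace
      - A.trace * B.trace * C.trace := by
  simp only [Matrix.mul_apply, Matrix.trace, Fin.sum_univ_two, Matrix.diag]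
  ring

lemma m2_nondeg (A B X : M2 ℂ) (hD : (A * B - B * A).det ≠ 0) (h1 : X.trace = 0)
    (h2 : (A * X).trace = 0) (h3 : (B * X).trace = 0) (h4 : (A * B * X).trace = 0) : X = 0 := by
  have key : ∀ i j, (A * B - B * A).det * X i j = 0 := by
    simp only [Matrix.mul_apply, Matrix.trace, Fin.sum_univ_two, Matrix.det_fin_two,
      Matrix.diag, Matrix.sub_apply] at h1 h2 h3 h4 ⊢
    generalize A 0 0 = a, A 0 1 = b, A 1 0 = c, A 1 1 = d, B 0 0 = e, B 0 1 = f,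
      B 1 0 = g, B 1 1 = h at *
    generalize hp : X 0 0 = p, hq : X 0 1 = q, hr : X 1 0 = r, ht : X 1 1 = t at *
    intro i j
    fin_cases i <;> fin_cases j
    all_goals simp only [Fin.zero_eta, Fin.mk_one, Fin.isValue, hp, hq, hr, ht]
    · linear_combination (-1) * (((f*(c*e+d*g)-g*(a*f+b*h)))*(h2-d*h1)+(-(b*(c*e+d*g)-c*(a*f+b*h)))*(h3-h*h1)+((b*g-c*f))*(h4-(c*f+d*h)*h1))
    · linear_combination (-1) * ((((e-h)*(a*f+b*h)-f*((a*e+b*g)-(c*f+d*h))))*(h2-d*h1)+(-((a-d)*(a*f+b*h)-b*((a*e+b*g)-(c*f+d*h))))*(h3-h*h1)+(((a-d)*f-b*(e-h)))*(h4-(c*f+d*h)*h1))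
    · linear_combination (-1) * ((-((e-h)*(c*e+d*g)-g*((a*e+b*g)-(c*f+d*h))))*(h2-d*h1)+(((a-d)*(c*e+d*g)-c*((a*e+b*g)-(c*f+d*h))))*(h3-h*h1)+(-((a-d)*g-c*(e-h)))*(h4-(c*f+d*h)*h1))
    · linear_combination ((a * e + b * g - (e * a + f * c)) * (c * f + d * h - (g * b + h * d)) - (a * f + b * h - (e * b + f * d)) * (c * e + d * g - (g * a + h * c))) * h1 - (-1) * (((f*(c*e+d*g)-g*(a*f+b*h)))*(h2-d*h1)+(-(b*(c*e+d*g)-c*(a*f+b*h)))*(h3-h*h1)+((b*g-c*f))*(h4-(c*f+d*h)*h1))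
  ext i j
  exact (mul_eq_zero.1 (key i j)).resolve_left hD

lemma m2_comm_det (A B : M2 ℂ) (hA : A.det = 1) (hB : B.det = 1) :
    (A * B - B * A).det = 4 - A.trace ^ 2 - B.trace ^ 2 - (A * B).trace ^ 2
      + A.trace * B.trace * (A * B).trace := by
  have : (A * B - B * A).det = 4 * A.det * B.det - A.trace ^ 2 * B.det - B.trace ^ 2 * A.det
      - (A * B).trace ^ 2 + A.trace * B.trace * (A * B).trace := by
    simp only [Matrix.mul_apply, Matrix.trace, Fin.sum_univ_two, Matrix.det_fin_two,
      Matrix.diag, Matrix.sub_apply]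
    ring
  rw [this, hA, hB]; ring

/-! ### All traces lie in the ring generated by the seven traces -/

section TraceRing

variable {S : Type*} [CommRing S] (R : Subring S)

lemma span_left_mul {N : Submodule R (M2 S)} {s : Set (M2 S)} (hN : N = Submodule.span R s)
    (L : M2 S) (h : ∀ x ∈ s, L * x ∈ N) : ∀ X ∈ N, L * X ∈ N := by
  intro X hX
  rw [hN] at hX
  induction hX using Submodule.span_induction with
  | mem x hx => exact h x hx
  | zero => simp
  | add x y _ _ hx hy => rw [mul_add]; exact N.add_mem hx hy
  | smul a x _ hx =>
    have : L * (a • x) = a • (L * x) := by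
      rw [Subring.smul_def, Subring.smul_def, Matrix.mul_smul]
    rw [this]; exact N.smul_mem a hx

lemma smul_mem_sub {N : Submodule R (M2 S)} {a : S} (ha : a ∈ R) {X : M2 S} (hX : X ∈ N) :
    a • X ∈ N := N.smul_mem (⟨a, ha⟩ : R) hX

lemma mul_mem_of_polar {N : Submodule R (M2 S)} {X Y f : M2 S}
    (hx : X.trace ∈ R) (hy : Y.trace ∈ R) (hxy : (X * Y).trace ∈ R)
    (hf : f ∈ N) (hXf : X * f ∈ N) (hYf : Y * f ∈ N) (hXYf : X * (Y * f) ∈ N) :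
    Y * (X * f) ∈ N := by
  have : Y * (X * f) = -(X * (Y * f)) + X.trace • (Y * f) + Y.trace • (X * f)
      + ((X * Y).trace - X.trace * Y.trace) • f := by
    rw [← mul_assoc, m2_polar X Y]
    simp [add_mul, mul_assoc]
  rw [this]
  exact N.add_mem (N.add_mem (N.add_mem (N.neg_mem hXYf) (smul_mem_sub R hx hYf))
    (smul_mem_sub R hy hXf)) (smul_mem_sub R (R.sub_mem hxy (R.mul_mem hx hy)) hf)

lemma mul_mem_of_ch {N : Submodule R (M2 S)} {X f : M2 S} (hd : X.det = 1)
    (hx : X.trace ∈ R) (hf : f ∈ N) (hXf : X * f ∈ N) : X * (X * f) ∈ N := by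
  have : X * (X * f) = X.trace • (X * f) - f := by
    rw [← mul_assoc, m2_ch X hd]; simp [sub_mul]
  rw [this]
  exact N.sub_mem (smul_mem_sub R hx hXf) hf

lemma trace_mem (E : F3 →* M2 S) (hdet : ∀ g, (E g).det = 1)
    (hR : ∀ j, (E (w j)).trace ∈ R) (g : F3) : (E g).trace ∈ R := by
  set A := E (FreeGroup.of 0) with hA
  set B := E (FreeGroup.of 1) with hB
  set C := E (FreeGroup.of 2) with hC
  have h0 : A.trace ∈ R := hR 0
  have h1 : B.trace ∈ R := hR 1
  have h2 : C.trace ∈ R := hR 2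
  have h3 : (A * B).trace ∈ R := by simpa [w] using hR 3
  have h4 : (A * C).trace ∈ R := by simpa [w] using hR 4
  have h5 : (B * C).trace ∈ R := by simpa [w] using hR 5
  have h6 : (A * (B * C)).trace ∈ R := by simpa [w, mul_assoc] using hR 6
  obtain ⟨N, hN⟩ : ∃ N : Submodule R (M2 S), N = Submodule.span R
    {1, C, B, B * C, A, A * C, A * B, A * (B * C)} := ⟨_, rfl⟩
  have e1 : (1 : M2 S) ∈ N := by rw [hN]; exact Submodule.subset_span (by simp)
  have eC : C ∈ N := by rw [hN]; exact Submodule.subset_span (by simp)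
  have eB : B ∈ N := by rw [hN]; exact Submodule.subset_span (by simp)
  have eBC : B * C ∈ N := by rw [hN]; exact Submodule.subset_span (by simp)
  have eA : A ∈ N := by rw [hN]; exact Submodule.subset_span (by simp)
  have eAC : A * C ∈ N := by rw [hN]; exact Submodule.subset_span (by simp)
  have eAB : A * B ∈ N := by rw [hN]; exact Submodule.subset_span (by simp)
  have eABC : A * (B * C) ∈ N := by rw [hN]; exact Submodule.subset_span (by simp)
  have sA : ∀ X ∈ N, A * X ∈ N := by
    refine span_left_mul R hN A ?_
    rintro x (rfl | rfl | rfl | rfl | rfl | rfl | rfl | rfl)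
    · simpa using eA
    · exact eAC
    · exact eAB
    · exact eABC
    · simpa using mul_mem_of_ch R (hdet _) h0 e1 (by simpa using eA)
    · exact mul_mem_of_ch R (hdet _) h0 eC eAC
    · exact mul_mem_of_ch R (hdet _) h0 eB eAB
    · exact mul_mem_of_ch R (hdet _) h0 eBC eABC
  have bC : B * B ∈ N := by simpa using mul_mem_of_ch R (hdet _) h1 e1 (by simpa using eB)
  have bBC : B * (B * C) ∈ N := mul_mem_of_ch R (hdet _) h1 eC eBC
  have sB : ∀ X ∈ N, B * X ∈ N := by
    refine span_left_mul R hN B ?_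
    have aux : ∀ f ∈ N, B * f ∈ N → B * (A * f) ∈ N := fun f hf hBf =>
      mul_mem_of_polar R h0 h1 h3 hf (sA _ hf) hBf (sA _ hBf)
    rintro x (rfl | rfl | rfl | rfl | rfl | rfl | rfl | rfl)
    · simpa using eB
    · exact eBC
    · exact bC
    · exact bBC
    · simpa using aux 1 e1 (by simpa using eB)
    · exact aux _ eC eBC
    · exact aux _ eB bC
    · exact aux _ eBC bBC
  have cC : C * C ∈ N := by simpa using mul_mem_of_ch R (hdet _) h2 e1 (by simpa using eC)
  have sC : ∀ X ∈ N, C * X ∈ N := by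
    refine span_left_mul R hN C ?_
    have auxA : ∀ f ∈ N, C * f ∈ N → C * (A * f) ∈ N := fun f hf hBf =>
      mul_mem_of_polar R h0 h2 h4 hf (sA _ hf) hBf (sA _ hBf)
    have auxB : ∀ f ∈ N, C * f ∈ N → C * (B * f) ∈ N := fun f hf hBf =>
      mul_mem_of_polar R h1 h2 h5 hf (sB _ hf) hBf (sB _ hBf)
    have cB : C * B ∈ N := by simpa using auxB 1 e1 (by simpa using eC)
    rintro x (rfl | rfl | rfl | rfl | rfl | rfl | rfl | rfl)
    · simpa using eC
    · exact cC
    · exact cB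
    · exact auxB _ eC cC
    · simpa using auxA 1 e1 (by simpa using eC)
    · exact auxA _ eC cC
    · exact auxA _ eB cB
    · exact auxA _ eBC (auxB _ eC cC)
  have sgen : ∀ i, ∀ X ∈ N, E (FreeGroup.of i) * X ∈ N := by
    intro i; fin_cases i
    · exact sA
    · exact sB
    · exact sC
  have tgen : ∀ i, (E (FreeGroup.of i)).trace ∈ R := by
    intro i; fin_cases i
    · exact h0
    · exact h1
    · exact h2
  have sinv : ∀ i, ∀ X ∈ N, E (FreeGroup.of i)⁻¹ * X ∈ N := by
    intro i X hX
    have hinv : E (FreeGroup.of i)⁻¹ =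
        (E (FreeGroup.of i)).trace • 1 - E (FreeGroup.of i) := by
      have h := m2_ch _ (hdet (FreeGroup.of i))
      have h' : E (FreeGroup.of i)⁻¹ * E (FreeGroup.of i) = 1 := by
        rw [← map_mul]; simp
      calc E (FreeGroup.of i)⁻¹ = E (FreeGroup.of i)⁻¹ *
            ((E (FreeGroup.of i)).trace • E (FreeGroup.of i)
              - E (FreeGroup.of i) * E (FreeGroup.of i)) := by
              rw [h]; simp
        _ = _ := by
          rw [mul_sub, Matrix.mul_smul, h', ← mul_assoc, h', one_mul]
    rw [hinv, sub_mul, Matrix.smul_mul, one_mul]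
    exact N.sub_mem (smul_mem_sub R (tgen i) hX) (sgen i X hX)
  have sall : ∀ g : F3, ∀ X ∈ N, E g * X ∈ N := by
    intro g
    induction g using FreeGroup.induction_on with
    | C1 => simp
    | of i => exact sgen i
    | inv_of i _ => exact sinv i
    | mul x y hx hy =>
      intro X hX
      rw [map_mul, mul_assoc]
      exact hx _ (hy _ hX)
  have hg : E g ∈ N := by simpa using sall g 1 e1
  rw [hN] at hg
  generalize E g = Y at hg
  induction hg using Submodule.span_induction with
  | mem x hx =>
    rcases hx with (rfl | rfl | rfl | rfl | rfl | rfl | rfl | rfl)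
    · simp only [Matrix.trace_one]; exact natCast_mem R _
    all_goals assumption
  | zero => simp
  | add x y _ _ hx hy => rw [Matrix.trace_add]; exact R.add_mem hx hy
  | smul a x _ hx =>
    rw [Subring.smul_def, Matrix.trace_smul]
    exact R.mul_mem a.2 hx

end TraceRing

/-! ### Representations and periodicity -/

/-- The trace of a word. -/
def T (ρ : F3 →* SL2C) (g : F3) : ℂ := Matrix.trace (ρ g : M2 ℂ)

/-- The underlying matrix representation. -/
def mrep (ρ : F3 →* SL2C) : F3 →* M2 ℂ where
  toFun g := (ρ g : M2 ℂ)
  map_one' := by simp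
  map_mul' x y := by simp

/-- The matrix representation over the ring of sequences attached to a sequence of
representations. -/
def seqrep (r : ℕ → (F3 →* SL2C)) : F3 →* M2 (ℕ → ℂ) where
  toFun g := Matrix.of fun p q k => (r k g : M2 ℂ) p q
  map_one' := by
    ext p q k
    fin_cases p <;> fin_cases q <;> simp
  map_mul' x y := by
    ext p q k
    simp [Matrix.mul_apply]

/-- Periodicity, tested on all words. -/
def EP (ρ : F3 →* SL2C) : Prop :=
  ∀ (α : MulAut F3) (g : F3), (Set.range fun k : ℕ => T ρ ((α ^ k) g)).Finite

/-- The subring of sequences with finite range. -/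
def finRange : Subring (ℕ → ℂ) where
  carrier := {f | (Set.range f).Finite}
  mul_mem' := by
    intro a b ha hb
    refine ((ha.prod hb).image fun p : ℂ × ℂ => p.1 * p.2).subset ?_
    rintro _ ⟨k, rfl⟩
    exact ⟨(a k, b k), ⟨⟨k, rfl⟩, ⟨k, rfl⟩⟩, rfl⟩
  one_mem' := (Set.finite_singleton (1 : ℂ)).subset (by rintro _ ⟨k, rfl⟩; simp)
  add_mem' := by
    intro a b ha hb
    refine ((ha.prod hb).image fun p : ℂ × ℂ => p.1 + p.2).subset ?_
    rintro _ ⟨k, rfl⟩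
    exact ⟨(a k, b k), ⟨⟨k, rfl⟩, ⟨k, rfl⟩⟩, rfl⟩
  zero_mem' := (Set.finite_singleton (0 : ℂ)).subset (by rintro _ ⟨k, rfl⟩; simp)
  neg_mem' := by
    intro a ha
    refine (ha.image fun p : ℂ => -p).subset ?_
    rintro _ ⟨k, rfl⟩
    exact ⟨a k, ⟨k, rfl⟩, rfl⟩

lemma chi_eq (A₁ A₂ A₃ : SL2C) (α : MulAut F3) (i : Fin 7) :
    chi A₁ A₂ A₃ α i = T (rho A₁ A₂ A₃) (α (w i)) / 2 := rfl

lemma EP_of_elemPeriodic (A₁ A₂ A₃ : SL2C) (h : ElemPeriodic A₁ A₂ A₃) :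
    EP (rho A₁ A₂ A₃) := by
  intro α g
  have key := trace_mem finRange
    (seqrep fun k => (rho A₁ A₂ A₃).comp (α ^ k).toMonoidHom) ?_ ?_ g
  · have hs : (Set.range (Matrix.trace (seqrep
        (fun k => (rho A₁ A₂ A₃).comp (α ^ k).toMonoidHom) g))).Finite := key
    convert hs using 2
    funext k
    simp [T, seqrep, Matrix.trace, Fin.sum_univ_two]
  · intro g
    funext k
    have := ((rho A₁ A₂ A₃) ((α ^ k) g)).2
    rw [Matrix.det_fin_two] at this ⊢
    simpa [seqrep] using this
  · intro j
    change (Set.range _).Finite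
    refine ((h α).image fun f : Fin 7 → ℂ => 2 * f j).subset ?_
    rintro _ ⟨k, rfl⟩
    refine ⟨_, ⟨k, rfl⟩, ?_⟩
    simp [chi_eq, T, seqrep, Matrix.trace, Fin.sum_univ_two]
    ring

lemma EP.comp {ρ : F3 →* SL2C} (h : EP ρ) (β : MulAut F3) : EP (ρ.comp β.toMonoidHom) := by
  intro α g
  convert h (β * α * β⁻¹) (β g) using 3 with k
  rw [conj_pow]
  simp [T]

lemma exists_aut (f g : Fin 3 → F3) (h1 : ∀ i, FreeGroup.lift f (g i) = FreeGroup.of i)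
    (h2 : ∀ i, FreeGroup.lift g (f i) = FreeGroup.of i) :
    ∃ β : MulAut F3, ∀ i, β (FreeGroup.of i) = f i := by
  refine ⟨MonoidHom.toMulEquiv (FreeGroup.lift f) (FreeGroup.lift g) ?_ ?_, ?_⟩
  · ext i; simp [h2]
  · ext i; simp [h1]
  · intro i; simp

/-- The trace of a word is the sum of a root of unity and its inverse. -/
def RU (ρ : F3 →* SL2C) (g : F3) : Prop :=
  ∃ (μ : ℂ) (N : ℕ), 0 < N ∧ μ ^ N = 1 ∧ T ρ g = μ + μ⁻¹

lemma rec_fin (u : ℕ → ℂ) (μ : ℂ) (hμ : μ ≠ 0)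
    (hu : ∀ k, u (k + 2) = (μ + μ⁻¹) * u (k + 1) - u k) (hf : (Set.range u).Finite) :
    (∃ N : ℕ, 0 < N ∧ μ ^ N = 1) ∨ (u 0 = 0 ∧ u 1 = 0) := by
  by_cases hN : ∃ N : ℕ, 0 < N ∧ μ ^ N = 1
  · exact Or.inl hN
  right
  have hpow : ∀ k l : ℕ, k < l → μ ^ k ≠ μ ^ l := by
    intro k l hkl h
    apply hN
    refine ⟨l - k, by omega, ?_⟩
    have h2 : μ ^ l = μ ^ k * μ ^ (l - k) := by rw [← pow_add]; congr 1; omega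
    rw [h2] at h
    have := mul_left_cancel₀ (pow_ne_zero k hμ) ((mul_one _).trans h)
    exact this.symm
  have hfin : (Set.range fun k => (u k, u (k + 1))).Finite := by
    refine (hf.prod hf).subset ?_
    rintro _ ⟨k, rfl⟩
    exact ⟨⟨k, rfl⟩, ⟨k + 1, rfl⟩⟩
  have hninj : ¬ Function.Injective fun k => (u k, u (k + 1)) := fun hi =>
    Set.infinite_range_of_injective hi hfin
  obtain ⟨k, l, hkl, h0, h1⟩ : ∃ k l, k < l ∧ u k = u l ∧ u (k + 1) = u (l + 1) := by
    simp only [Function.Injective, not_forall] at hninj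
    obtain ⟨a, b, hab, hne⟩ := hninj
    rw [Prod.mk.injEq] at hab
    rcases lt_or_gt_of_ne hne with h | h
    · exact ⟨a, b, h, hab.1, hab.2⟩
    · exact ⟨b, a, h, hab.1.symm, hab.2.symm⟩
  have hv : ∀ k, u (k + 1) - μ⁻¹ * u k = μ ^ k * (u 1 - μ⁻¹ * u 0) := by
    intro k
    induction k with
    | zero => simp
    | succ k ih =>
      rw [pow_succ, mul_right_comm, ← ih, hu]
      field_simp
      ring
  have hv' : ∀ k, u (k + 1) - μ * u k = (μ⁻¹) ^ k * (u 1 - μ * u 0) := by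
    intro k
    induction k with
    | zero => simp
    | succ k ih =>
      rw [pow_succ, mul_right_comm, ← ih, hu]
      field_simp
      ring
  have e1 : u 1 - μ⁻¹ * u 0 = 0 := by
    by_contra hne
    have := hv k
    rw [h0, h1, hv l] at this
    exact hpow k l hkl (mul_right_cancel₀ hne this).symm
  have e2 : u 1 - μ * u 0 = 0 := by
    by_contra hne
    have := hv' k
    rw [h0, h1, hv' l] at this
    have h3 := (mul_right_cancel₀ hne this).symm
    rw [inv_pow, inv_pow] at h3
    exact hpow k l hkl (inv_injective h3)
  have hμ2 : μ - μ⁻¹ ≠ 0 := by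
    intro h
    apply hN
    refine ⟨2, by norm_num, ?_⟩
    have : μ = μ⁻¹ := sub_eq_zero.1 h
    field_simp at this
    exact this
  have hu0 : u 0 = 0 := by
    have : (μ - μ⁻¹) * u 0 = 0 := by linear_combination e1 - e2
    exact (mul_eq_zero.1 this).resolve_left hμ2
  refine ⟨hu0, ?_⟩
  rw [hu0] at e1
  simpa using e1

lemma exists_add_inv (t : ℂ) : ∃ μ : ℂ, μ ≠ 0 ∧ t = μ + μ⁻¹ := by
  obtain ⟨s, hs⟩ := IsAlgClosed.exists_pow_nat_eq (t ^ 2 - 4) (n := 2) (by norm_num)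
  have h1 : ((t + s) / 2) * ((t - s) / 2) = 1 := by linear_combination (-1 / 4) * hs
  have h0 : (t + s) / 2 ≠ 0 := left_ne_zero_of_mul_eq_one h1
  refine ⟨(t + s) / 2, h0, ?_⟩
  rw [← eq_inv_of_mul_eq_one_right h1]
  ring

lemma T_mul_pow (ρ : F3 →* SL2C) (p g : F3) (k : ℕ) :
    T ρ (p * g ^ (k + 2)) = T ρ g * T ρ (p * g ^ (k + 1)) - T ρ (p * g ^ k) := by
  have h := m2_ch (ρ g : M2 ℂ) (ρ g).2
  have h2 : ((ρ (p * g ^ (k + 2)) : SL2C) : M2 ℂ) =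
      (ρ (p * g ^ k) : M2 ℂ) * ((ρ g : M2 ℂ) * (ρ g : M2 ℂ)) := by
    rw [pow_add, ← mul_assoc, map_mul, pow_two]
    simp
  have h3 : ((ρ (p * g ^ (k + 1)) : SL2C) : M2 ℂ) = (ρ (p * g ^ k) : M2 ℂ) * (ρ g : M2 ℂ) := by
    rw [pow_add, ← mul_assoc, map_mul]
    simp
  unfold T
  rw [h2, h3, h, mul_sub, Matrix.mul_smul, Matrix.trace_sub, Matrix.trace_smul]
  simp

lemma RU_or {ρ : F3 →* SL2C} (h : EP ρ) (α : MulAut F3) (p g : F3) (hp : α p = p * g)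
    (hg : α g = g) : RU ρ g ∨ (T ρ p = 0 ∧ T ρ (p * g) = 0) := by
  have hpow : ∀ k : ℕ, (α ^ k) p = p * g ^ k := by
    intro k
    induction k with
    | zero => simp
    | succ k ih =>
      rw [pow_succ', MulAut.mul_apply, ih, map_mul, map_pow, hp, hg, mul_assoc, ← pow_succ']
  obtain ⟨μ, hμ, ht⟩ := exists_add_inv (T ρ g)
  have := rec_fin (fun k => T ρ (p * g ^ k)) μ hμ
    (fun k => by simp only [T_mul_pow, ht]) (by simpa [hpow] using h α p)
  rcases this with ⟨N, hN, hN'⟩ | ⟨h0, h1⟩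
  · exact Or.inl ⟨μ, N, hN, hN', ht⟩
  · right
    simpa using And.intro h0 h1

local notation "x₀" => (FreeGroup.of (0 : Fin 3) : F3)
local notation "x₁" => (FreeGroup.of (1 : Fin 3) : F3)
local notation "x₂" => (FreeGroup.of (2 : Fin 3) : F3)

lemma RU_one {ρ : F3 →* SL2C} (h : EP ρ) : RU ρ x₁ := by
  by_contra hn
  obtain ⟨α, hα⟩ := exists_aut ![x₀ * x₁, x₁, x₂] ![x₀ * x₁⁻¹, x₁, x₂]
    (by intro i; fin_cases i <;> simp) (by intro i; fin_cases i <;> simp)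
  obtain ⟨β, hβ⟩ := exists_aut ![x₀, x₁, x₂ * x₁] ![x₀, x₁, x₂ * x₁⁻¹]
    (by intro i; fin_cases i <;> simp) (by intro i; fin_cases i <;> simp)
  have hα0 := hα 0
  have hα1 := hα 1
  have hβ0 := hβ 0
  have hβ1 := hβ 1
  have hβ2 := hβ 2
  simp at hα0 hα1 hβ0 hβ1 hβ2
  obtain ⟨a1, a2⟩ := (RU_or h α x₀ x₁ hα0 hα1).resolve_left hn
  obtain ⟨a3, a4⟩ := (RU_or h β x₂ x₁ hβ2 hβ1).resolve_left hn
  obtain ⟨a5, a6⟩ := (RU_or h β (x₀ * x₂) x₁ (by simp [hβ0, hβ2, mul_assoc])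
    hβ1).resolve_left hn
  have key := m2_fricke (ρ x₀ : M2 ℂ) (ρ x₁ : M2 ℂ) (ρ x₂ : M2 ℂ)
  have t0 : ((ρ x₀ : SL2C) : M2 ℂ).trace = 0 := a1
  have t2 : ((ρ x₂ : SL2C) : M2 ℂ).trace = 0 := a3
  have t01 : ((ρ x₀ : M2 ℂ) * (ρ x₁ : M2 ℂ)).trace = 0 := by simpa [T] using a2
  have t12 : ((ρ x₁ : M2 ℂ) * (ρ x₂ : M2 ℂ)).trace = 0 := by
    rw [Matrix.trace_mul_comm]; simpa [T] using a4
  have t02 : ((ρ x₀ : M2 ℂ) * (ρ x₂ : M2 ℂ)).trace = 0 := by simpa [T] using a5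
  have t021 : ((ρ x₀ : M2 ℂ) * (ρ x₂ : M2 ℂ) * (ρ x₁ : M2 ℂ)).trace = 0 := by
    simpa [T] using a6
  have d0 := (ρ x₀).2
  have d1 := (ρ x₁).2
  have d2 := (ρ x₂).2
  rw [t0, t2, t01, t12, t02, t021, d0, d1, d2] at key
  have key2 : (T ρ x₁ - 2) * (T ρ x₁ + 2) = 0 := by
    unfold T
    linear_combination -key
  rcases mul_eq_zero.1 key2 with h1 | h1
  · exact hn ⟨1, 1, by norm_num, by norm_num, by linear_combination h1⟩
  · exact hn ⟨-1, 2, by norm_num, by norm_num, by norm_num; linear_combination h1⟩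

lemma RU_aut {ρ : F3 →* SL2C} (h : EP ρ) (β : MulAut F3) : RU ρ (β x₁) := RU_one (h.comp β)

lemma RU_words {ρ : F3 →* SL2C} (h : EP ρ) (j : Fin 7) : RU ρ (w j) := by
  suffices hs : ∃ f g : Fin 3 → F3, (∀ i, FreeGroup.lift f (g i) = FreeGroup.of i) ∧
      (∀ i, FreeGroup.lift g (f i) = FreeGroup.of i) ∧ f 1 = w j by
    obtain ⟨f, g, h1, h2, h3⟩ := hs
    obtain ⟨β, hβ⟩ := exists_aut f g h1 h2
    rw [← h3, ← hβ 1]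
    exact RU_aut h β
  fin_cases j
  · exact ⟨![x₁, x₀, x₂], ![x₁, x₀, x₂], by intro i; fin_cases i <;> simp,
      by intro i; fin_cases i <;> simp, rfl⟩
  · exact ⟨![x₀, x₁, x₂], ![x₀, x₁, x₂], by intro i; fin_cases i <;> simp,
      by intro i; fin_cases i <;> simp, rfl⟩
  · exact ⟨![x₀, x₂, x₁], ![x₀, x₂, x₁], by intro i; fin_cases i <;> simp,
      by intro i; fin_cases i <;> simp, rfl⟩
  · exact ⟨![x₀, x₀ * x₁, x₂], ![x₀, x₀⁻¹ * x₁, x₂], by intro i; fin_cases i <;> simp,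
      by intro i; fin_cases i <;> simp, rfl⟩
  · exact ⟨![x₀, x₀ * x₂, x₁], ![x₀, x₂, x₀⁻¹ * x₁], by intro i; fin_cases i <;> simp,
      by intro i; fin_cases i <;> simp, rfl⟩
  · exact ⟨![x₀, x₁ * x₂, x₂], ![x₀, x₁ * x₂⁻¹, x₂], by intro i; fin_cases i <;> simp,
      by intro i; fin_cases i <;> simp, rfl⟩
  · exact ⟨![x₀, x₀ * x₁ * x₂, x₂], ![x₀, x₀⁻¹ * x₁ * x₂⁻¹, x₂],
      by intro i; fin_cases i <;> simp [mul_assoc],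
      by intro i; fin_cases i <;> simp [mul_assoc], rfl⟩

/-- Irreducibility of the pair of the first two generators. -/
def Irr (ρ : F3 →* SL2C) : Prop :=
  ((ρ x₀ : M2 ℂ) * (ρ x₁ : M2 ℂ) - (ρ x₁ : M2 ℂ) * (ρ x₀ : M2 ℂ)).det ≠ 0

lemma RU_comm {ρ : F3 →* SL2C} (h : EP ρ) (hI : Irr ρ) : RU ρ (x₀ * x₁ * x₀⁻¹ * x₁⁻¹) := by
  by_contra hn
  obtain ⟨β, hβ⟩ := exists_aut ![x₀, x₁, x₂ * (x₀ * x₁ * x₀⁻¹ * x₁⁻¹)]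
    ![x₀, x₁, x₂ * (x₀ * x₁ * x₀⁻¹ * x₁⁻¹)⁻¹]
    (by intro i; fin_cases i <;> simp [mul_assoc]) (by intro i; fin_cases i <;> simp [mul_assoc])
  have hβ0 := hβ 0
  have hβ1 := hβ 1
  have hβ2 := hβ 2
  simp only [Matrix.cons_val] at hβ0 hβ1 hβ2
  have hw : β (x₀ * x₁ * x₀⁻¹ * x₁⁻¹) = x₀ * x₁ * x₀⁻¹ * x₁⁻¹ := by
    simp [hβ0, hβ1]
  have a1 := ((RU_or h β x₂ _ hβ2 hw).resolve_left hn).1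
  have a2 := ((RU_or h β (x₀ * x₂) _ (by simp [hβ0, hβ2, mul_assoc]) hw).resolve_left hn).1
  have a3 := ((RU_or h β (x₁ * x₂) _ (by simp [hβ1, hβ2, mul_assoc]) hw).resolve_left hn).1
  have a4 := ((RU_or h β (x₀ * x₁ * x₂) _ (by simp [hβ0, hβ1, hβ2, mul_assoc])
    hw).resolve_left hn).1
  have h0 := m2_nondeg (ρ x₀ : M2 ℂ) (ρ x₁ : M2 ℂ) (ρ x₂ : M2 ℂ) hI a1
    (by simpa [T] using a2) (by simpa [T] using a3) (by simpa [T] using a4)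
  have := (ρ x₂).2
  rw [h0] at this
  simp at this

lemma T_comm (ρ : F3 →* SL2C) : T ρ (x₀ * x₁ * x₀⁻¹ * x₁⁻¹) =
    T ρ x₀ ^ 2 + T ρ x₁ ^ 2 + T ρ (x₀ * x₁) ^ 2 - T ρ x₀ * T ρ x₁ * T ρ (x₀ * x₁) - 2 := by
  have d0 := (ρ x₀).2
  have d1 := (ρ x₁).2
  simp only [T, map_mul, map_inv, Matrix.SpecialLinearGroup.coe_mul,
    Matrix.SpecialLinearGroup.coe_inv, Matrix.adjugate_fin_two]
  generalize (ρ x₀ : M2 ℂ) = A at *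
  generalize (ρ x₁ : M2 ℂ) = B at *
  have key : (A * B * !![A 1 1, -A 0 1; -A 1 0, A 0 0] * !![B 1 1, -B 0 1; -B 1 0, B 0 0]).trace
      = A.trace ^ 2 * B.det + B.trace ^ 2 * A.det + (A * B).trace ^ 2
        - A.trace * B.trace * (A * B).trace - 2 * A.det * B.det := by
    simp only [Matrix.mul_apply, Matrix.trace, Fin.sum_univ_two, Matrix.det_fin_two, Matrix.diag]
    simp
    ring
  rw [key, d0, d1]
  ring

/-! ### The irreducible case -/

lemma real_bound (x y z p q r t : ℝ) (hx : x ^ 2 ≤ 4)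
    (hk : x ^ 2 + y ^ 2 + p ^ 2 - x * y * p - 4 < 0)
    (hf : t * (x * q + y * r + z * p - x * y * z - t) =
      x ^ 2 + y ^ 2 + z ^ 2 + p ^ 2 + q ^ 2 + r ^ 2 - x * y * p - y * z * q - x * z * r
        + p * q * r - 4) : z ^ 2 ≤ 4 := by
  have hx' : x ^ 2 < 4 := by
    rcases lt_or_eq_of_le hx with h | h
    · exact h
    · exfalso
      have : 4 * (x ^ 2 + y ^ 2 + p ^ 2 - x * y * p - 4) =
        (2 * p - x * y) ^ 2 - (4 - x ^ 2) * (4 - y ^ 2) := by ring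
      rw [h] at this
      nlinarith [sq_nonneg (2 * p - x * y)]
  obtain ⟨D, hD⟩ : ∃ D, D = (4 - x ^ 2) * (4 - y ^ 2) - (x * y - 2 * p) ^ 2 := ⟨_, rfl⟩
  have hDpos : 0 < D := by rw [hD]; nlinarith
  have hid : (4 - z ^ 2) * (D * (4 - x ^ 2)) =
      4 * (4 - x ^ 2) * (2 * t - (x * q + y * r + z * p - x * y * z)) ^ 2
      + ((4 - x ^ 2) * (y * z - 2 * q) - (x * y - 2 * p) * (x * z - 2 * r)) ^ 2
      + D * (x * z - 2 * r) ^ 2 := by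
    rw [hD]
    linear_combination 16 * (4 - x ^ 2) * hf
  have hnn : 0 ≤ (4 - z ^ 2) * (D * (4 - x ^ 2)) := by
    rw [hid]
    have : 0 ≤ 4 - x ^ 2 := by linarith
    positivity
  have hpos : 0 < D * (4 - x ^ 2) := mul_pos hDpos (by linarith)
  have := nonneg_of_mul_nonneg_left hnn hpos
  linarith

lemma root_of_unity_real {z : ℂ} {N : ℕ} (hN : 0 < N) (hz : z ^ N = 1) :
    (z + z⁻¹).im = 0 ∧ (z + z⁻¹).re ^ 2 ≤ 4 := by
  have h1 : ‖z‖ = 1 := Complex.norm_eq_one_of_pow_eq_one hz hN.ne'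
  have h2 : z⁻¹ = (starRingEnd ℂ) z := Complex.inv_eq_conj h1
  have h3 : |z.re| ≤ 1 := h1 ▸ Complex.abs_re_le_norm z
  rw [h2]
  refine ⟨by simp, ?_⟩
  have := abs_le.1 h3
  simp only [Complex.add_re, Complex.conj_re]
  nlinarith

/-- Algebraic integers of `K`, all of whose conjugates are real. -/
def realInt (K : Type*) [Field K] : Subring K where
  carrier := {x | IsIntegral ℤ x ∧ ∀ φ : K →+* ℂ, (φ x).im = 0}
  mul_mem' := fun {a b} ha hb => ⟨ha.1.mul hb.1, fun φ => by simp [ha.2 φ, hb.2 φ]⟩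
  one_mem' := ⟨isIntegral_one, fun φ => by simp⟩
  add_mem' := fun {a b} ha hb => ⟨ha.1.add hb.1, fun φ => by simp [ha.2 φ, hb.2 φ]⟩
  zero_mem' := ⟨isIntegral_zero, fun φ => by simp⟩
  neg_mem' := fun {a} ha => ⟨ha.1.neg, fun φ => by simp [ha.2 φ]⟩

lemma finite_traces {ρ : F3 →* SL2C} (h : EP ρ) (hI : Irr ρ) : (Set.range (T ρ)).Finite := by
  choose μ N hN hμ hT using RU_words h
  obtain ⟨ν, M, hM, hν, hTν⟩ := RU_comm h hI
  obtain ⟨L, hL⟩ : ∃ L, L = M * ∏ j, N j := ⟨_, rfl⟩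
  have hLpos : 0 < L := by rw [hL]; exact Nat.mul_pos hM (Finset.prod_pos fun j _ => hN j)
  have hμL : ∀ j, μ j ^ L = 1 := by
    intro j
    obtain ⟨c, hc⟩ : N j ∣ L := by
      rw [hL]; exact Dvd.dvd.mul_left (Finset.dvd_prod_of_mem N (Finset.mem_univ j)) M
    rw [hc, pow_mul, hμ, one_pow]
  have hνL : ν ^ L = 1 := by rw [hL, pow_mul, hν, one_pow]
  obtain ⟨K, hK⟩ : ∃ K, K = IntermediateField.adjoin ℚ {z : ℂ | z ^ L = 1} := ⟨_, rfl⟩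
  have hfinS : Finite {z : ℂ | z ^ L = 1} := by
    have : {z : ℂ | z ^ L = 1} ⊆ (Polynomial.nthRoots L (1 : ℂ)).toFinset := by
      intro z hz
      simpa [Polynomial.mem_nthRoots hLpos] using hz
    exact ((Finset.finite_toSet _).subset this).to_subtype
  have hfd : FiniteDimensional ℚ K := by
    rw [hK]
    refine IntermediateField.finiteDimensional_adjoin ?_
    intro z hz
    exact IsIntegral.of_pow hLpos (by rw [show z ^ L = 1 from hz]; exact isIntegral_one)
  have hNF : NumberField K := { to_charZero := inferInstance, to_finiteDimensional := hfd }
  have hroot : ∀ z : ℂ, z ^ L = 1 → ∃ x : K, (x : ℂ) = z + z⁻¹ ∧ x ∈ realInt K ∧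
      ∀ φ : K →+* ℂ, (φ x).re ^ 2 ≤ 4 := by
    intro z hz
    have hzK : z ∈ K := by rw [hK]; exact IntermediateField.subset_adjoin _ _ hz
    obtain ⟨y, hy⟩ : ∃ y : K, y = ⟨z, hzK⟩ := ⟨_, rfl⟩
    have hyz : (y : ℂ) = z := by rw [hy]
    have hyL : y ^ L = 1 := by
      apply Subtype.ext
      push_cast
      rw [hyz, hz]
    have hφ : ∀ φ : K →+* ℂ, (φ y) ^ L = 1 := by
      intro φ; rw [← map_pow, hyL, map_one]
    refine ⟨y + y⁻¹, by push_cast; rw [hyz], ⟨?_, ?_⟩, ?_⟩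
    · refine IsIntegral.add ?_ ?_
      · exact IsIntegral.of_pow hLpos (by rw [hyL]; exact isIntegral_one)
      · exact IsIntegral.of_pow hLpos (by rw [inv_pow, hyL, inv_one]; exact isIntegral_one)
    · intro φ
      rw [map_add, map_inv₀]
      exact (root_of_unity_real hLpos (hφ φ)).1
    · intro φ
      rw [map_add, map_inv₀]
      exact (root_of_unity_real hLpos (hφ φ)).2
  have hall : ∀ g, ∃ x : K, (x : ℂ) = T ρ g ∧ x ∈ realInt K := by
    intro g
    have := trace_mem ((realInt K).map (algebraMap K ℂ)) (mrep ρ) (fun g => (ρ g).2) ?_ g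
    · obtain ⟨x, hx, hx'⟩ := this
      exact ⟨x, hx', hx⟩
    · intro j
      obtain ⟨x, hx, hx', -⟩ := hroot (μ j) (hμL j)
      refine ⟨x, hx', ?_⟩
      change (x : ℂ) = T ρ (w j)
      rw [hx, hT]
  choose t ht htR using hall
  have hκ : T ρ (x₀ * x₁ * x₀⁻¹ * x₁⁻¹) ≠ 2 := by
    rw [T_comm]
    intro h2
    apply hI
    rw [m2_comm_det _ _ (ρ x₀).2 (ρ x₁).2]
    have e : T ρ (x₀ * x₁) = ((ρ x₀ : M2 ℂ) * (ρ x₁ : M2 ℂ)).trace := by simp [T]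
    rw [e] at h2
    unfold T at h2
    linear_combination -h2
  have hbound : ∀ g, ∀ φ : K →+* ℂ, ‖φ (t g)‖ ≤ 2 := by
    intro g φ
    have hre : ∀ g, φ (t g) = ((φ (t g)).re : ℂ) := by
      intro g
      apply Complex.ext
      · simp
      · simpa using (htR g).2 φ
    obtain ⟨τ, hτ⟩ : ∃ τ : F3 → ℝ, ∀ g, φ (t g) = (τ g : ℂ) := ⟨_, hre⟩
    -- the first generator
    have hx : τ x₀ ^ 2 ≤ 4 := by
      obtain ⟨x, hx, -, hx'⟩ := hroot (μ 0) (hμL 0)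
      have e : x = t x₀ := by
        apply Subtype.ext
        rw [hx, ht, ← hT 0]
        rfl
      have := hx' φ
      rw [e, hτ] at this
      simpa using this
    -- the commutator
    have hc4 : τ (x₀ * x₁ * x₀⁻¹ * x₁⁻¹) ^ 2 ≤ 4 := by
      obtain ⟨x, hx, -, hx'⟩ := hroot ν hνL
      have e : x = t (x₀ * x₁ * x₀⁻¹ * x₁⁻¹) := by
        apply Subtype.ext
        rw [hx, ht, ← hTν]
      have := hx' φ
      rw [e, hτ] at this
      simpa using this
    have hcne : τ (x₀ * x₁ * x₀⁻¹ * x₁⁻¹) ≠ 2 := by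
      intro h2
      have h3 : φ (t (x₀ * x₁ * x₀⁻¹ * x₁⁻¹)) = φ 2 := by
        rw [hτ, h2, map_ofNat]; simp
      have h4 := φ.injective h3
      apply hκ
      rw [← ht, h4]
      rfl
    have hceq : τ (x₀ * x₁ * x₀⁻¹ * x₁⁻¹) = τ x₀ ^ 2 + τ x₁ ^ 2 + τ (x₀ * x₁) ^ 2
        - τ x₀ * τ x₁ * τ (x₀ * x₁) - 2 := by
      have e1 : t (x₀ * x₁ * x₀⁻¹ * x₁⁻¹) = t x₀ ^ 2 + t x₁ ^ 2 + t (x₀ * x₁) ^ 2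
        - t x₀ * t x₁ * t (x₀ * x₁) - 2 := by
        apply Subtype.ext
        push_cast
        simp only [ht]
        exact T_comm ρ
      have e2 := congrArg φ e1
      simp only [map_sub, map_add, map_mul, map_pow, hτ, map_ofNat] at e2
      exact_mod_cast e2
    have hk : τ x₀ ^ 2 + τ x₁ ^ 2 + τ (x₀ * x₁) ^ 2
        - τ x₀ * τ x₁ * τ (x₀ * x₁) - 4 < 0 := by
      have h5 : τ (x₀ * x₁ * x₀⁻¹ * x₁⁻¹) ≤ 2 := by nlinarith
      have h6 := lt_of_le_of_ne h5 hcne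
      linarith
    have hfr : τ (x₀ * x₁ * g) * (τ x₀ * τ (x₁ * g) + τ x₁ * τ (x₀ * g) + τ g * τ (x₀ * x₁)
          - τ x₀ * τ x₁ * τ g - τ (x₀ * x₁ * g)) =
        τ x₀ ^ 2 + τ x₁ ^ 2 + τ g ^ 2 + τ (x₀ * x₁) ^ 2 + τ (x₁ * g) ^ 2 + τ (x₀ * g) ^ 2
        - τ x₀ * τ x₁ * τ (x₀ * x₁) - τ x₁ * τ g * τ (x₁ * g) - τ x₀ * τ g * τ (x₀ * g)
        + τ (x₀ * x₁) * τ (x₁ * g) * τ (x₀ * g) - 4 := by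
      have e1 : t (x₀ * x₁ * g) * (t x₀ * t (x₁ * g) + t x₁ * t (x₀ * g) + t g * t (x₀ * x₁)
          - t x₀ * t x₁ * t g - t (x₀ * x₁ * g)) =
        t x₀ ^ 2 + t x₁ ^ 2 + t g ^ 2 + t (x₀ * x₁) ^ 2 + t (x₁ * g) ^ 2 + t (x₀ * g) ^ 2
        - t x₀ * t x₁ * t (x₀ * x₁) - t x₁ * t g * t (x₁ * g) - t x₀ * t g * t (x₀ * g)
        + t (x₀ * x₁) * t (x₁ * g) * t (x₀ * g) - 4 := by
        apply Subtype.ext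
        push_cast
        simp only [ht]
        have f1 := m2_fricke (ρ x₀ : M2 ℂ) (ρ x₁ : M2 ℂ) (ρ g : M2 ℂ)
        have f2 := m2_fricke_sum (ρ x₀ : M2 ℂ) (ρ x₁ : M2 ℂ) (ρ g : M2 ℂ)
        rw [(ρ x₀).2, (ρ x₁).2, (ρ g).2] at f1
        have h4c : ((4 : K) : ℂ) = 4 := rfl
        rw [h4c]
        simp only [T, map_mul, Matrix.SpecialLinearGroup.coe_mul]
        linear_combination f1 - ((ρ x₀ : M2 ℂ) * (ρ x₁ : M2 ℂ) * (ρ g : M2 ℂ)).trace * f2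
      have e2 := congrArg φ e1
      simp only [map_sub, map_add, map_mul, map_pow, hτ, map_ofNat] at e2
      exact_mod_cast e2
    have hz := real_bound _ _ _ _ _ _ _ hx hk hfr
    rw [hτ, Complex.norm_real, Real.norm_eq_abs]
    exact abs_le_of_sq_le_sq (by linarith) (by norm_num)
  have hfin := NumberField.Embeddings.finite_of_norm_le K ℂ 2
  refine (hfin.image fun x : K => (x : ℂ)).subset ?_
  rintro _ ⟨g, rfl⟩
  exact ⟨t g, ⟨(htR g).1, hbound g⟩, ht g⟩

lemma finite_range {ρ : F3 →* SL2C} (h : EP ρ) (hI : Irr ρ) : (Set.range ρ).Finite := by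
  have hT := finite_traces h hI
  have hprod := hT.prod (hT.prod (hT.prod hT))
  let Φ : SL2C → ℂ × ℂ × ℂ × ℂ := fun X => ((X : M2 ℂ).trace, ((ρ x₀ : M2 ℂ) * (X : M2 ℂ)).trace,
    ((ρ x₁ : M2 ℂ) * (X : M2 ℂ)).trace, ((ρ x₀ : M2 ℂ) * (ρ x₁ : M2 ℂ) * (X : M2 ℂ)).trace)
  have hinj : Function.Injective Φ := by
    intro X Y hXY
    simp only [Φ, Prod.mk.injEq] at hXY
    obtain ⟨a1, a2, a3, a4⟩ := hXY
    have := m2_nondeg (ρ x₀ : M2 ℂ) (ρ x₁ : M2 ℂ) ((X : M2 ℂ) - (Y : M2 ℂ)) hI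
      (by rw [Matrix.trace_sub, a1, sub_self]) (by rw [mul_sub, Matrix.trace_sub, a2, sub_self])
      (by rw [mul_sub, Matrix.trace_sub, a3, sub_self])
      (by rw [mul_sub, Matrix.trace_sub, a4, sub_self])
    exact Subtype.ext (sub_eq_zero.1 this)
  refine Set.Finite.of_finite_image (f := Φ) (hprod.subset ?_) hinj.injOn
  rintro _ ⟨_, ⟨g, rfl⟩, rfl⟩
  exact ⟨⟨g, rfl⟩, ⟨x₀ * g, by simp [T, Φ]⟩, ⟨x₁ * g, by simp [T, Φ]⟩,
    ⟨x₀ * x₁ * g, by simp [T, Φ]⟩⟩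

/-! ### The reducible case -/

/-- `v` is an eigenvector (or zero). -/
def Eig (A : M2 ℂ) (v : Fin 2 → ℂ) : Prop := ∃ l : ℂ, A *ᵥ v = l • v

lemma parallel_of_ker {D : M2 ℂ} {v u : Fin 2 → ℂ} (hD : D ≠ 0) (hv : v ≠ 0)
    (h1 : D *ᵥ v = 0) (h2 : D *ᵥ u = 0) : ∃ l : ℂ, u = l • v := by
  have hcross : v 0 * u 1 - v 1 * u 0 = 0 := by
    by_contra hne
    apply hD
    have a : ∀ i, D i 0 * v 0 + D i 1 * v 1 = 0 := fun i => by
      simpa [Matrix.mulVec, dotProduct, Fin.sum_univ_two] using congrFun h1 i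
    have b : ∀ i, D i 0 * u 0 + D i 1 * u 1 = 0 := fun i => by
      simpa [Matrix.mulVec, dotProduct, Fin.sum_univ_two] using congrFun h2 i
    have c0 : ∀ i, D i 0 = 0 := fun i => by
      have : (v 0 * u 1 - v 1 * u 0) * D i 0 = 0 := by
        linear_combination u 1 * a i - v 1 * b i
      exact (mul_eq_zero.1 this).resolve_left hne
    have c1 : ∀ i, D i 1 = 0 := fun i => by
      have : (v 0 * u 1 - v 1 * u 0) * D i 1 = 0 := by
        linear_combination v 0 * b i - u 0 * a i
      exact (mul_eq_zero.1 this).resolve_left hne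
    ext i j
    fin_cases j
    · exact c0 i
    · exact c1 i
  by_cases h0 : v 0 = 0
  · have h1' : v 1 ≠ 0 := by
      intro h
      apply hv
      ext i; fin_cases i
      · exact h0
      · exact h
    refine ⟨u 1 / v 1, ?_⟩
    ext i; fin_cases i
    · have : u 0 = 0 := by
        rw [h0, zero_mul, zero_sub, neg_eq_zero] at hcross
        exact (mul_eq_zero.1 hcross).resolve_left h1'
      simp [h0, this]
    · simp; field_simp
  · refine ⟨u 0 / v 0, ?_⟩
    ext i; fin_cases i
    · simp; field_simp
    · simp; field_simp; linear_combination hcross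

lemma exists_eig (A : M2 ℂ) : ∃ v : Fin 2 → ℂ, v ≠ 0 ∧ Eig A v := by
  obtain ⟨l, hl⟩ := Module.End.exists_eigenvalue (Matrix.toLin' A)
  obtain ⟨v, hv⟩ := hl.exists_hasEigenvector
  refine ⟨v, hv.2, l, ?_⟩
  simpa using hv.apply_eq_smul

lemma eig_of_sub {A : M2 ℂ} {v : Fin 2 → ℂ} {l : ℂ} (h : A *ᵥ v = l • v) :
    (A - l • (1 : M2 ℂ)) *ᵥ v = 0 := by
  rw [Matrix.sub_mulVec, h, Matrix.smul_mulVec, Matrix.one_mulVec, sub_self]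

lemma eig_of_comm {A B : M2 ℂ} (h : A * B = B * A) :
    ∃ v : Fin 2 → ℂ, v ≠ 0 ∧ Eig A v ∧ Eig B v := by
  obtain ⟨v, hv, l, hl⟩ := exists_eig A
  by_cases hs : A - l • (1 : M2 ℂ) = 0
  · obtain ⟨u, hu, hu'⟩ := exists_eig B
    refine ⟨u, hu, ⟨l, ?_⟩, hu'⟩
    rw [sub_eq_zero.1 hs, Matrix.smul_mulVec, Matrix.one_mulVec]
  · refine ⟨v, hv, ⟨l, hl⟩, ?_⟩
    refine parallel_of_ker hs hv (eig_of_sub hl) (eig_of_sub ?_)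
    rw [Matrix.mulVec_mulVec, h, ← Matrix.mulVec_mulVec, hl, Matrix.mulVec_smul]

lemma common_eig (A B : M2 ℂ) (h : (A * B - B * A).det = 0) :
    ∃ v : Fin 2 → ℂ, v ≠ 0 ∧ Eig A v ∧ Eig B v := by
  by_cases hD : A * B - B * A = 0
  · exact eig_of_comm (sub_eq_zero.1 hD)
  obtain ⟨v, hv, hDv⟩ := Matrix.exists_mulVec_eq_zero_iff.2 h
  have key : ∀ X : M2 ℂ, (X * (A * B - B * A)).trace = 0 →
      (A * B - B * A) *ᵥ (X *ᵥ v) = 0 := by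
    intro X hX
    have hp := m2_polar X (A * B - B * A)
    have htr : (A * B - B * A).trace = 0 := by
      rw [Matrix.trace_sub, Matrix.trace_mul_comm, sub_self]
    rw [hX, htr] at hp
    rw [Matrix.mulVec_mulVec, hp]
    simp [Matrix.add_mulVec, Matrix.neg_mulVec, Matrix.smul_mulVec, ← Matrix.mulVec_mulVec, hDv]
  refine ⟨v, hv, parallel_of_ker hD hv hDv (key A ?_), parallel_of_ker hD hv hDv (key B ?_)⟩
  · rw [mul_sub, Matrix.trace_sub, ← mul_assoc, ← mul_assoc, Matrix.trace_mul_comm (A * B) A,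
      ← mul_assoc, sub_self]
  · rw [mul_sub, Matrix.trace_sub, ← mul_assoc, ← mul_assoc, Matrix.trace_mul_comm (B * B) A,
      Matrix.trace_mul_comm (B * A) B, ← mul_assoc, Matrix.trace_mul_comm A (B * B), sub_self]

lemma eig_char {A : M2 ℂ} (hA : A.det = 1) {v : Fin 2 → ℂ} (hv : v ≠ 0) {l : ℂ}
    (h : A *ᵥ v = l • v) : l * l = A.trace * l - 1 := by
  have h1 : (A * A) *ᵥ v = (l * l) • v := by
    rw [← Matrix.mulVec_mulVec, h, Matrix.mulVec_smul, h, smul_smul]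
  rw [m2_ch A hA, Matrix.sub_mulVec, Matrix.smul_mulVec, Matrix.one_mulVec, h, smul_smul] at h1
  have h2 : (A.trace * l - 1 - l * l) • v = 0 := by
    rw [sub_smul, sub_smul, one_smul, h1, sub_self]
  have h3 := (smul_eq_zero.1 h2).resolve_right hv
  linear_combination -h3

lemma eig_ne_zero {A : M2 ℂ} (hA : A.det = 1) {v : Fin 2 → ℂ} (hv : v ≠ 0) {l : ℂ}
    (h : A *ᵥ v = l • v) : l ≠ 0 := by
  rintro rfl
  have := eig_char hA hv h
  simp at this

lemma Eig.of_smul {A : M2 ℂ} {v : Fin 2 → ℂ} {k : ℂ} (hk : k ≠ 0) (h : Eig A (k • v)) :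
    Eig A v := by
  obtain ⟨l, hl⟩ := h
  refine ⟨l, ?_⟩
  rw [Matrix.mulVec_smul, smul_comm] at hl
  exact smul_right_injective _ hk hl

lemma triple_eig (A B C : M2 ℂ) (hA : A.det = 1) (hB : B.det = 1) (hC : C.det = 1)
    (h1 : (A * B - B * A).det = 0) (h2 : (A * C - C * A).det = 0)
    (h3 : (B * C - C * B).det = 0) (h4 : (A * (B * C) - (B * C) * A).det = 0) :
    ∃ v : Fin 2 → ℂ, v ≠ 0 ∧ Eig A v ∧ Eig B v ∧ Eig C v := by
  by_cases hs : ∃ l : ℂ, A - l • (1 : M2 ℂ) = 0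
  · obtain ⟨l, hl⟩ := hs
    obtain ⟨v, hv, b, c⟩ := common_eig B C h3
    refine ⟨v, hv, ⟨l, ?_⟩, b, c⟩
    rw [sub_eq_zero.1 hl, Matrix.smul_mulVec, Matrix.one_mulVec]
  have hs' : ∀ l : ℂ, A - l • (1 : M2 ℂ) ≠ 0 := fun l hl => hs ⟨l, hl⟩
  obtain ⟨v, hv, ⟨l, hl⟩, ⟨b, hb⟩⟩ := common_eig A B h1
  obtain ⟨v', hv', ⟨l', hl'⟩, ⟨c, hc⟩⟩ := common_eig A C h2
  obtain ⟨v'', hv'', ⟨l'', hl''⟩, hbc⟩ := common_eig A (B * C) h4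
  have hsame : ∀ (m : ℂ) (u u' : Fin 2 → ℂ), u ≠ 0 → u' ≠ 0 → A *ᵥ u = m • u →
      A *ᵥ u' = m • u' → ∃ k : ℂ, k ≠ 0 ∧ u' = k • u := by
    intro m u u' hu hu' e e'
    obtain ⟨k, hk⟩ := parallel_of_ker (hs' m) hu (eig_of_sub e) (eig_of_sub e')
    refine ⟨k, ?_, hk⟩
    rintro rfl
    simp at hk
    exact hu' hk
  by_cases e1 : l' = l
  · subst e1
    obtain ⟨k, hk, rfl⟩ := hsame _ _ _ hv hv' hl hl'
    exact ⟨v, hv, ⟨_, hl⟩, ⟨b, hb⟩, Eig.of_smul hk ⟨c, hc⟩⟩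
  by_cases e2 : l'' = l
  · subst e2
    obtain ⟨k, hk, rfl⟩ := hsame _ _ _ hv hv'' hl hl''
    obtain ⟨ε, hε⟩ := Eig.of_smul hk hbc
    refine ⟨v, hv, ⟨_, hl⟩, ⟨b, hb⟩, ε / b, ?_⟩
    have hb0 := eig_ne_zero hB hv hb
    have hz : B *ᵥ (C *ᵥ v - (ε / b) • v) = 0 := by
      rw [Matrix.mulVec_sub, Matrix.mulVec_mulVec, hε, Matrix.mulVec_smul, hb, smul_smul,
        div_mul_cancel₀ _ hb0, sub_self]
    exact sub_eq_zero.1 (Matrix.eq_zero_of_mulVec_eq_zero (by rw [hB]; exact one_ne_zero) hz)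
  have e3 : l'' = l' := by
    have q1 := eig_char hA hv hl
    have q2 := eig_char hA hv' hl'
    have q3 := eig_char hA hv'' hl''
    have r1 : (l' - l) * (l' + l - A.trace) = 0 := by linear_combination q2 - q1
    have r2 : (l'' - l) * (l'' + l - A.trace) = 0 := by linear_combination q3 - q1
    have s1 := (mul_eq_zero.1 r1).resolve_left (sub_ne_zero.2 e1)
    have s2 := (mul_eq_zero.1 r2).resolve_left (sub_ne_zero.2 e2)
    linear_combination s2 - s1
  subst e3
  obtain ⟨k, hk, rfl⟩ := hsame _ _ _ hv' hv'' hl' hl''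
  obtain ⟨ε, hε⟩ := Eig.of_smul hk hbc
  have hc0 := eig_ne_zero hC hv' hc
  refine ⟨v', hv', ⟨_, hl'⟩, ⟨ε / c, ?_⟩, ⟨c, hc⟩⟩
  rw [← Matrix.mulVec_mulVec, hc, Matrix.mulVec_smul] at hε
  rw [div_eq_inv_mul, mul_smul, ← hε, smul_smul, inv_mul_cancel₀ hc0, one_smul]

lemma exists_eig_of_not_irr {ρ : F3 →* SL2C}
    (h : ∀ β : MulAut F3, ¬ Irr (ρ.comp β.toMonoidHom)) :
    ∃ v : Fin 2 → ℂ, v ≠ 0 ∧ ∀ i : Fin 3, Eig (ρ (FreeGroup.of i) : M2 ℂ) v := by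
  have key : ∀ f g : Fin 3 → F3, (∀ i, FreeGroup.lift f (g i) = FreeGroup.of i) →
      (∀ i, FreeGroup.lift g (f i) = FreeGroup.of i) →
      ((ρ (f 0) : M2 ℂ) * (ρ (f 1) : M2 ℂ) - (ρ (f 1) : M2 ℂ) * (ρ (f 0) : M2 ℂ)).det = 0 := by
    intro f g h1 h2
    obtain ⟨β, hβ⟩ := exists_aut f g h1 h2
    have := h β
    rw [Irr, not_not] at this
    simpa [hβ] using this
  have k1 := key ![x₀, x₁, x₂] ![x₀, x₁, x₂] (by intro i; fin_cases i <;> simp)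
    (by intro i; fin_cases i <;> simp)
  have k2 := key ![x₀, x₂, x₁] ![x₀, x₂, x₁] (by intro i; fin_cases i <;> simp)
    (by intro i; fin_cases i <;> simp)
  have k3 := key ![x₁, x₂, x₀] ![x₂, x₀, x₁] (by intro i; fin_cases i <;> simp)
    (by intro i; fin_cases i <;> simp)
  have k4 := key ![x₀, x₁ * x₂, x₂] ![x₀, x₁ * x₂⁻¹, x₂] (by intro i; fin_cases i <;> simp)
    (by intro i; fin_cases i <;> simp)
  obtain ⟨v, hv, a, b, c⟩ := triple_eig (ρ x₀ : M2 ℂ) (ρ x₁ : M2 ℂ) (ρ x₂ : M2 ℂ)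
    (ρ x₀).2 (ρ x₁).2 (ρ x₂).2 k1 k2 k3 (by simpa using k4)
  refine ⟨v, hv, ?_⟩
  intro i; fin_cases i
  · exact a
  · exact b
  · exact c

lemma reducible_case {ρ : F3 →* SL2C} (hE : EP ρ)
    (h : ∀ β : MulAut F3, ¬ Irr (ρ.comp β.toMonoidHom)) :
    ∃ (L : F3 →* ℂˣ) (N : ℕ), 0 < N ∧ (∀ g, L g ^ N = 1) ∧
      ∀ g, T ρ g = (L g : ℂ) + (L g : ℂ)⁻¹ := by
  obtain ⟨v, hv, hev⟩ := exists_eig_of_not_irr h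
  choose l hl using hev
  have hl0 : ∀ i, l i ≠ 0 := fun i => eig_ne_zero (ρ _).2 hv (hl i)
  obtain ⟨L, hL⟩ : ∃ L : F3 →* ℂˣ, ∀ i, L (FreeGroup.of i) = Units.mk0 (l i) (hl0 i) :=
    ⟨FreeGroup.lift fun i => Units.mk0 (l i) (hl0 i), fun i => by simp⟩
  have hinv : ∀ g, (ρ g : M2 ℂ) *ᵥ v = (L g : ℂ) • v →
      (ρ g⁻¹ : M2 ℂ) *ᵥ v = (L g⁻¹ : ℂ) • v := by
    intro g hg
    have h1 : (ρ g⁻¹ : M2 ℂ) * (ρ g : M2 ℂ) = 1 := by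
      rw [← Matrix.SpecialLinearGroup.coe_mul, ← map_mul]; simp
    have h2 : v = (L g : ℂ) • (ρ g⁻¹ : M2 ℂ) *ᵥ v := by
      rw [← Matrix.mulVec_smul, ← hg, Matrix.mulVec_mulVec, h1, Matrix.one_mulVec]
    conv_rhs => rw [h2]
    rw [smul_smul, map_inv L, Units.inv_mul, one_smul]
  have hact : ∀ g, (ρ g : M2 ℂ) *ᵥ v = (L g : ℂ) • v := by
    intro g
    induction g using FreeGroup.induction_on with
    | C1 => simp
    | of i => rw [hL]; exact hl i
    | inv_of i hi => exact hinv _ hi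
    | mul x y hx hy =>
      rw [map_mul, map_mul, Matrix.SpecialLinearGroup.coe_mul, ← Matrix.mulVec_mulVec, hy,
        Matrix.mulVec_smul, hx, smul_smul, mul_comm]
      simp
  have htr : ∀ g, T ρ g = (L g : ℂ) + (L g : ℂ)⁻¹ := by
    intro g
    have h1 := eig_char (ρ g).2 hv (hact g)
    have h0 : (L g : ℂ) ≠ 0 := (L g).ne_zero
    unfold T
    field_simp
    linear_combination -h1
  have hru : ∀ i : Fin 3, ∃ N : ℕ, 0 < N ∧ L (FreeGroup.of i) ^ N = 1 := by
    intro i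
    obtain ⟨μ, N, hN, hμ, ht⟩ : RU ρ (FreeGroup.of i) := by
      fin_cases i
      · exact RU_words hE 0
      · exact RU_words hE 1
      · exact RU_words hE 2
    refine ⟨N, hN, ?_⟩
    rw [htr] at ht
    have h0 : (L (FreeGroup.of i) : ℂ) ≠ 0 := (L _).ne_zero
    have hμ0 : μ ≠ 0 := by
      rintro rfl
      rw [zero_pow hN.ne'] at hμ
      exact zero_ne_one hμ
    apply Units.ext
    push_cast
    generalize (L (FreeGroup.of i) : ℂ) = z at *
    have hfac : (z - μ) * (z - μ⁻¹) = 0 := by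
      have e : (z + z⁻¹ - (μ + μ⁻¹)) * z = 0 := by rw [ht]; ring
      have e1 : z⁻¹ * z = 1 := inv_mul_cancel₀ h0
      have e2 : μ * μ⁻¹ = 1 := mul_inv_cancel₀ hμ0
      linear_combination e - e1 + e2
    rcases mul_eq_zero.1 hfac with h1 | h1
    · rw [sub_eq_zero.1 h1, hμ]
    · rw [sub_eq_zero.1 h1, inv_pow, hμ, inv_one]
  choose n hn hn1 using hru
  refine ⟨L, ∏ i, n i, Finset.prod_pos fun i _ => hn i, ?_, htr⟩
  intro g
  have hgen : ∀ i, L (FreeGroup.of i) ^ (∏ i, n i) = 1 := by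
    intro i
    obtain ⟨c, hc⟩ := Finset.dvd_prod_of_mem n (Finset.mem_univ i)
    rw [hc, pow_mul, hn1, one_pow]
  induction g using FreeGroup.induction_on with
  | C1 => simp
  | of i => exact hgen i
  | inv_of i hi => rw [map_inv, inv_pow, hi, inv_one]
  | mul x y hx hy => rw [map_mul, mul_pow, hx, hy, one_mul]

lemma exists_angle {z : ℂ} (h : ‖z‖ = 1) :
    ∃ t : ℝ, z = Complex.exp ((2 * π * t : ℝ) * Complex.I) := by
  refine ⟨Complex.arg z / (2 * π), ?_⟩
  have h1 : 2 * π * (Complex.arg z / (2 * π)) = Complex.arg z := by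
    field_simp
  rw [h1]
  have := Complex.norm_mul_exp_arg_mul_I z
  rw [h] at this
  simpa using this.symm

lemma exp_add_inv_half (s : ℝ) : (Complex.exp (s * Complex.I) + (Complex.exp (s * Complex.I))⁻¹) / 2
    = (Real.cos s : ℂ) := by
  rw [← Complex.exp_neg, Complex.ofReal_cos, Complex.cos, neg_mul]

lemma finite_of_traces (A₁ A₂ A₃ : SL2C) (h : (Set.range (T (rho A₁ A₂ A₃))).Finite) :
    (Set.range fun α : MulAut (FreeGroup (Fin 3)) => chi A₁ A₂ A₃ α).Finite := by
  refine (Set.Finite.pi' (fun _ : Fin 7 => h.image fun z => z / 2)).subset ?_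
  rintro _ ⟨α, rfl⟩ i
  exact ⟨_, ⟨α (w i), rfl⟩, rfl⟩

theorem stmt11 (A₁ A₂ A₃ : SL2C)
    (htr : ∀ i : Fin 7, (chi A₁ A₂ A₃ 1 i).im = 0)
    (hper : ElemPeriodic A₁ A₂ A₃) :
    ( -- (i) at most one coordinate of p is nonzero
      (∀ i j : Fin 7, i ≠ j → chi A₁ A₂ A₃ 1 i = 0 ∨ chi A₁ A₂ A₃ 1 j = 0)
      ∨
      -- (ii) p vanishes on one of the seven position sets
      (∃ j : Fin 7, ∀ s ∈ SS j, chi A₁ A₂ A₃ 1 s = 0)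
      ∨
      -- (iii) p ∈ Image(Π₃)
      (∃ t₁ t₂ t₃ : ℝ, ∀ i : Fin 7, chi A₁ A₂ A₃ 1 i = (Pi3 t₁ t₂ t₃ i : ℂ))
      ∨
      -- (iv) ⟨A₁,A₂,A₃⟩ is finite
      ((Subgroup.closure {A₁, A₂, A₃} : Subgroup SL2C) : Set SL2C).Finite )
    ∧
    (Set.range fun α : MulAut (FreeGroup (Fin 3)) => chi A₁ A₂ A₃ α).Finite := by
  have hE := EP_of_elemPeriodic A₁ A₂ A₃ hper
  by_cases hI : ∃ β : MulAut F3, Irr ((rho A₁ A₂ A₃).comp β.toMonoidHom)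
  · obtain ⟨β, hβ⟩ := hI
    have hfin := finite_range (hE.comp β) hβ
    have hfin' : (Set.range (rho A₁ A₂ A₃)).Finite := by
      refine hfin.subset ?_
      rintro _ ⟨g, rfl⟩
      exact ⟨β.symm g, by simp⟩
    refine ⟨Or.inr (Or.inr (Or.inr ?_)), finite_of_traces _ _ _ ?_⟩
    · refine hfin'.subset ?_
      rw [← MonoidHom.coe_range, SetLike.coe_subset_coe, Subgroup.closure_le]
      rintro x (rfl | rfl | rfl)
      · exact ⟨FreeGroup.of 0, by simp [rho]⟩
      · exact ⟨FreeGroup.of 1, by simp [rho]⟩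
      · exact ⟨FreeGroup.of 2, by simp [rho]⟩
    · refine (hfin'.image fun X : SL2C => (X : M2 ℂ).trace).subset ?_
      rintro _ ⟨g, rfl⟩
      exact ⟨_, ⟨g, rfl⟩, rfl⟩
  · obtain ⟨L, N, hN, hLN, hT⟩ := reducible_case hE fun β hβ => hI ⟨β, hβ⟩
    have hLN' : ∀ g, (L g : ℂ) ^ N = 1 := by
      intro g
      have := congrArg (fun u : ℂˣ => (u : ℂ)) (hLN g)
      simpa using this
    refine ⟨Or.inr (Or.inr (Or.inl ?_)), finite_of_traces _ _ _ ?_⟩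
    · have hang : ∀ i : Fin 3, ∃ t : ℝ, (L (FreeGroup.of i) : ℂ) =
          Complex.exp ((2 * π * t : ℝ) * Complex.I) := fun i =>
        exists_angle (Complex.norm_eq_one_of_pow_eq_one (hLN' _) hN.ne')
      choose t ht using hang
      have hgen : ∀ (g : F3) (s : ℝ), (L g : ℂ) = Complex.exp ((s : ℝ) * Complex.I) →
          T (rho A₁ A₂ A₃) g / 2 = (Real.cos s : ℂ) := by
        intro g s hs
        rw [hT, hs, exp_add_inv_half]
      refine ⟨t 0, t 1, t 2, ?_⟩
      intro i
      rw [chi_eq]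
      fin_cases i
      · exact hgen _ _ (ht 0)
      · exact hgen _ _ (ht 1)
      · exact hgen _ _ (ht 2)
      · refine hgen (x₀ * x₁) (2 * π * (t 0 + t 1)) ?_
        rw [map_mul, Units.val_mul, ht, ht, ← Complex.exp_add]
        congr 1; push_cast; ring
      · refine hgen (x₀ * x₂) (2 * π * (t 0 + t 2)) ?_
        rw [map_mul, Units.val_mul, ht, ht, ← Complex.exp_add]
        congr 1; push_cast; ring
      · refine hgen (x₁ * x₂) (2 * π * (t 1 + t 2)) ?_
        rw [map_mul, Units.val_mul, ht, ht, ← Complex.exp_add]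
        congr 1; push_cast; ring
      · refine hgen (x₀ * x₁ * x₂) (2 * π * (t 0 + t 1 + t 2)) ?_
        rw [map_mul, map_mul, Units.val_mul, Units.val_mul, ht, ht, ht, ← Complex.exp_add,
          ← Complex.exp_add]
        congr 1; push_cast; ring
    · refine ((Finset.finite_toSet (Polynomial.nthRoots N (1 : ℂ)).toFinset).image
        fun z : ℂ => z + z⁻¹).subset ?_
      rintro _ ⟨g, rfl⟩
      refine ⟨(L g : ℂ), ?_, (hT g).symm⟩
      simpa [Polynomial.mem_nthRoots hN] using hLN' g

end
end

section
/- Let θ = (θ₁,θ₂,θ₃) ∈ ℝ³ and let A_j = diag(e^{2πiθ_j}, e^{−2πiθ_j}) ∈ SL(2,ℂ) for j = 1,2,3 (so that χ(id) = Π₃(θ)). Then the triple (A₁,A₂,A₃) is elementwise-periodic if and only if θ₁, θ₂, θ₃ are all rational. -/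
open Matrix Real

noncomputable section

/-- The diagonal embedding `z ↦ diag(z, z⁻¹)`. -/
def dg : ℂˣ →* SL2C where
  toFun z := ⟨!![(z : ℂ), 0; 0, ((z⁻¹ : ℂˣ) : ℂ)], by simp [Matrix.det_fin_two]⟩
  map_one' := by
    ext i j; fin_cases i <;> fin_cases j <;> simp
  map_mul' x y := by
    apply Subtype.ext
    change !![((x * y : ℂˣ) : ℂ), 0; 0, (((x * y)⁻¹ : ℂˣ) : ℂ)] =
      !![(x : ℂ), 0; 0, ((x⁻¹ : ℂˣ) : ℂ)] * !![(y : ℂ), 0; 0, ((y⁻¹ : ℂˣ) : ℂ)]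
    ext i j; fin_cases i <;> fin_cases j <;>
      simp [Matrix.mul_apply, Fin.sum_univ_two, mul_comm]

lemma dg_coe (z : ℂˣ) : ((dg z : SL2C) : Matrix (Fin 2) (Fin 2) ℂ)
    = !![(z : ℂ), 0; 0, ((z⁻¹ : ℂˣ) : ℂ)] := rfl

lemma trace_dg (z : ℂˣ) : Matrix.trace ((dg z : SL2C) : Matrix (Fin 2) (Fin 2) ℂ)
    = (z : ℂ) + (z : ℂ)⁻¹ := by
  simp [dg_coe, Matrix.trace_fin_two]

/-- The unit `e^{2πiθ}`. -/
def eu (θ : ℝ) : ℂˣ := Units.mk0 (Complex.exp (2 * π * θ * Complex.I)) (Complex.exp_ne_zero _)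

lemma eu_pow_rat (θ : ℝ) (n : ℕ) (hn : 0 < n) (h : eu θ ^ n = 1) : ∃ q : ℚ, θ = q := by
  have h1 : Complex.exp (2 * π * θ * Complex.I) ^ n = 1 := by
    have := congrArg (fun z : ℂˣ => (z : ℂ)) h
    simpa [eu] using this
  rw [← Complex.exp_nat_mul, Complex.exp_eq_one_iff] at h1
  obtain ⟨m, hm⟩ := h1
  have hpi : (2 * π * Complex.I : ℂ) ≠ 0 := Complex.two_pi_I_ne_zero
  have h2 : (n : ℂ) * θ = m := by
    apply mul_right_cancel₀ hpi
    rw [← hm]; ring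
  have h3 : (n : ℝ) * θ = m := by exact_mod_cast h2
  have hn' : (n : ℝ) ≠ 0 := by positivity
  refine ⟨(m : ℚ) / n, ?_⟩
  push_cast
  rw [eq_div_iff hn', mul_comm]; exact h3

lemma eu_rat_pow (q : ℚ) : eu (q : ℝ) ^ q.den = 1 := by
  ext
  simp only [eu, Units.val_pow_eq_pow_val, Units.val_mk0, Units.val_one]
  rw [← Complex.exp_nat_mul, Complex.exp_eq_one_iff]
  refine ⟨q.num, ?_⟩
  have h : (q : ℂ) * q.den = q.num := by exact_mod_cast Rat.mul_den_eq_num q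
  rw [← h]; push_cast; ring

/-- The transvection `a_j ↦ a_j a_i`. -/
def transv (i j : Fin 3) (h : i ≠ j) : MulAut (FreeGroup (Fin 3)) :=
  MonoidHom.toMulEquiv
    (FreeGroup.lift fun l => if l = j then FreeGroup.of j * FreeGroup.of i else FreeGroup.of l)
    (FreeGroup.lift fun l => if l = j then FreeGroup.of j * (FreeGroup.of i)⁻¹ else FreeGroup.of l)
    (by
      ext l
      by_cases hl : l = j
      · subst hl; simp [h]
      · simp [hl])
    (by
      ext l
      by_cases hl : l = j
      · subst hl; simp [h]
      · simp [hl])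

lemma transv_of_i (i j : Fin 3) (h : i ≠ j) : transv i j h (FreeGroup.of i) = FreeGroup.of i := by
  simp [transv, h]

lemma transv_of_j (i j : Fin 3) (h : i ≠ j) :
    transv i j h (FreeGroup.of j) = FreeGroup.of j * FreeGroup.of i := by
  simp [transv]

lemma transv_pow (i j : Fin 3) (h : i ≠ j) (k : ℕ) :
    (transv i j h ^ k) (FreeGroup.of j) = FreeGroup.of j * FreeGroup.of i ^ k := by
  induction k with
  | zero => simp
  | succ k ih =>
    rw [pow_succ', MulAut.mul_apply, ih, map_mul, map_pow, transv_of_i, transv_of_j, pow_succ',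
      mul_assoc]

lemma fiber_finite (c : ℂ) : {z : ℂˣ | ((z : ℂ) + (z : ℂ)⁻¹) / 2 = c}.Finite := by
  by_cases hne : ∃ z₀ : ℂˣ, ((z₀ : ℂ) + (z₀ : ℂ)⁻¹) / 2 = c
  · obtain ⟨z₀, hz₀⟩ := hne
    refine (Set.toFinite {z₀, z₀⁻¹}).subset ?_
    intro z hz
    simp only [Set.mem_ofPred_eq] at hz
    have hz0 := z.ne_zero
    have hz1 := z₀.ne_zero
    have h1 : ((z : ℂ) - z₀) * (z * z₀ - 1) = 0 := by
      have h2 : (z : ℂ) + (z : ℂ)⁻¹ = z₀ + (z₀ : ℂ)⁻¹ := by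
        linear_combination 2 * hz - 2 * hz₀
      field_simp at h2
      linear_combination h2
    rcases mul_eq_zero.mp h1 with h | h
    · left; ext; linear_combination h
    · right
      simp only [Set.mem_singleton_iff]
      rw [eq_inv_iff_mul_eq_one]
      ext; push_cast; linear_combination h
  · convert Set.finite_empty
    ext z
    simp only [Set.mem_ofPred_eq, Set.mem_empty_iff_false, iff_false]
    exact fun hz => hne ⟨z, hz⟩

lemma torsion_of_finite (φ : FreeGroup (Fin 3) →* ℂˣ) (A₁ A₂ A₃ : SL2C)
    (hφ : ∀ g, rho A₁ A₂ A₃ g = dg (φ g)) (hE : ElemPeriodic A₁ A₂ A₃)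
    (i j : Fin 3) (h : i ≠ j) (s : Fin 7) (hs : w s = FreeGroup.of j) :
    ∃ n : ℕ, 0 < n ∧ φ (FreeGroup.of i) ^ n = 1 := by
  have hf := (hE (transv i j h)).image (fun v => v s)
  have hf2 : (Set.range fun k : ℕ => φ (FreeGroup.of j) * φ (FreeGroup.of i) ^ k).Finite := by
    refine (hf.biUnion (fun c _ => fiber_finite c)).subset ?_
    rintro _ ⟨k, rfl⟩
    simp only [Set.mem_iUnion]
    refine ⟨_, ⟨_, ⟨k, rfl⟩, rfl⟩, ?_⟩
    simp only [Set.mem_ofPred_eq, chi, hs, transv_pow, hφ, trace_dg]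
    rw [map_mul, map_pow]
  have hni : ¬ Function.Injective
      (fun k : ℕ => φ (FreeGroup.of j) * φ (FreeGroup.of i) ^ k) := fun hinj =>
    Set.infinite_range_of_injective hinj hf2
  have hni2 : ¬ Function.Injective (fun k : ℕ => φ (FreeGroup.of i) ^ k) := fun hinj =>
    hni fun a b hab => hinj (mul_left_cancel hab)
  rw [injective_pow_iff_not_isOfFinOrder, not_not, isOfFinOrder_iff_pow_eq_one] at hni2
  exact hni2

theorem stmt12 (θ₁ θ₂ θ₃ : ℝ) (A₁ A₂ A₃ : SL2C)
    (h₁ : (A₁ : Matrix (Fin 2) (Fin 2) ℂ) =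
      !![Complex.exp (2 * π * θ₁ * Complex.I), 0;
         0, Complex.exp (-(2 * π * θ₁ * Complex.I))])
    (h₂ : (A₂ : Matrix (Fin 2) (Fin 2) ℂ) =
      !![Complex.exp (2 * π * θ₂ * Complex.I), 0;
         0, Complex.exp (-(2 * π * θ₂ * Complex.I))])
    (h₃ : (A₃ : Matrix (Fin 2) (Fin 2) ℂ) =
      !![Complex.exp (2 * π * θ₃ * Complex.I), 0;
         0, Complex.exp (-(2 * π * θ₃ * Complex.I))]) :
    ElemPeriodic A₁ A₂ A₃ ↔
      ((∃ q : ℚ, θ₁ = q) ∧ (∃ q : ℚ, θ₂ = q) ∧ (∃ q : ℚ, θ₃ = q)) := by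
  set φ : FreeGroup (Fin 3) →* ℂˣ := FreeGroup.lift ![eu θ₁, eu θ₂, eu θ₃] with hφd
  have e1 : A₁ = dg (eu θ₁) := by
    apply Subtype.ext; rw [h₁, dg_coe]; simp [eu, Complex.exp_neg]
  have e2 : A₂ = dg (eu θ₂) := by
    apply Subtype.ext; rw [h₂, dg_coe]; simp [eu, Complex.exp_neg]
  have e3 : A₃ = dg (eu θ₃) := by
    apply Subtype.ext; rw [h₃, dg_coe]; simp [eu, Complex.exp_neg]
  have hφ' : rho A₁ A₂ A₃ = dg.comp φ := by
    apply FreeGroup.ext_hom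
    intro l
    fin_cases l <;> simp [rho, hφd, e1, e2, e3]
  have hφ : ∀ g, rho A₁ A₂ A₃ g = dg (φ g) := fun g => by rw [hφ']; rfl
  have p1 : φ (FreeGroup.of 0) = eu θ₁ := by simp [hφd]
  have p2 : φ (FreeGroup.of 1) = eu θ₂ := by simp [hφd]
  have p3 : φ (FreeGroup.of 2) = eu θ₃ := by simp [hφd]
  constructor
  · intro hE
    refine ⟨?_, ?_, ?_⟩
    · obtain ⟨n, hn, h⟩ := torsion_of_finite φ A₁ A₂ A₃ hφ hE 0 1 (by decide) 1 rfl
      exact eu_pow_rat _ n hn (p1 ▸ h)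
    · obtain ⟨n, hn, h⟩ := torsion_of_finite φ A₁ A₂ A₃ hφ hE 1 0 (by decide) 0 rfl
      exact eu_pow_rat _ n hn (p2 ▸ h)
    · obtain ⟨n, hn, h⟩ := torsion_of_finite φ A₁ A₂ A₃ hφ hE 2 0 (by decide) 0 rfl
      exact eu_pow_rat _ n hn (p3 ▸ h)
  · rintro ⟨⟨q₁, rfl⟩, ⟨q₂, rfl⟩, ⟨q₃, rfl⟩⟩ α
    set n : ℕ := q₁.den * q₂.den * q₃.den with hn
    have hn0 : n ≠ 0 := by
      simp [hn]
    haveI : NeZero n := ⟨hn0⟩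
    have t1 : eu (q₁ : ℝ) ^ n = 1 := by
      rw [hn, mul_assoc, pow_mul, eu_rat_pow, one_pow]
    have t2 : eu (q₂ : ℝ) ^ n = 1 := by
      rw [hn, mul_comm q₁.den, mul_assoc, pow_mul, eu_rat_pow, one_pow]
    have t3 : eu (q₃ : ℝ) ^ n = 1 := by
      rw [hn, mul_comm, pow_mul, eu_rat_pow, one_pow]
    have hom : (powMonoidHom n).comp φ = 1 := by
      apply FreeGroup.ext_hom
      intro l
      fin_cases l
      · simpa [p1] using t1
      · simpa [p2] using t2
      · simpa [p3] using t3
    have htor : ∀ g, φ g ∈ rootsOfUnity n ℂ := fun g => by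
      rw [mem_rootsOfUnity]
      exact DFunLike.congr_fun hom g
    refine (Set.finite_range (fun (u : Fin 7 → rootsOfUnity n ℂ) (i : Fin 7) =>
      (((u i : ℂˣ) : ℂ) + ((u i : ℂˣ) : ℂ)⁻¹) / 2)).subset ?_
    rintro _ ⟨k, rfl⟩
    refine ⟨fun i => ⟨φ ((α ^ k) (w i)), htor _⟩, ?_⟩
    funext i
    simp only [chi, hφ, trace_dg]

end
end
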